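/- Let S be a board whose number of black cells equals its number of white cells, say both equal to n, and fix bijections β : Fin n ≃ {black cells of S} and ω : Fin n ≃ {white cells of S}. Then the number of domino tilings τ of S with sign(π_τ) = 1 and the number of domino tilings τ of S with sign(π_τ) = −1 differ by at most one. -/

import Mathlib

open scoped Matrix

/-- A cell of the integer grid, representing the closed unit square
`[p₁, p₁+1] × [p₂, p₂+1] ⊆ ℝ²`. -/
abbrev Cell : Type := ℤ × ℤ

/-- The closed unit square in `ℝ²` corresponding to a cell. -/
def unitSquare (p : Cell) : Set (ℝ × ℝ) :=
  (Set.Icc (p.1 : ℝ) ((p.1 : ℝ) + 1)) ×ˢ (Set.Icc (p.2 : ℝ) ((p.2 : ℝ) + 1))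

/-- The region of the plane covered by a finite set of cells. -/
def Region (S : Finset Cell) : Set (ℝ × ℝ) := ⋃ p ∈ S, unitSquare p

/-- A board: a finite nonempty set of cells whose region is homeomorphic to the
closed unit disk in `ℝ²`. -/
def IsBoard (S : Finset Cell) : Prop :=
  S.Nonempty ∧
    Nonempty ((Region S) ≃ₜ (Metric.closedBall (0 : EuclideanSpace ℝ (Fin 2)) 1))

/-- A cell is black if the sum of its coordinates is even. -/
def IsBlackCell (p : Cell) : Prop := Even (p.1 + p.2)

instance (p : Cell) : Decidable (IsBlackCell p) := by
  unfold IsBlackCell; infer_instance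

/-- The black cells of `S`. -/
def blackCells (S : Finset Cell) : Finset Cell := S.filter IsBlackCell

/-- The white cells of `S`. -/
def whiteCells (S : Finset Cell) : Finset Cell := S.filter fun p => ¬ IsBlackCell p

/-- Two cells are adjacent when they share an edge. -/
def Adjacent (p q : Cell) : Prop :=
  p - q = (1, 0) ∨ p - q = (-1, 0) ∨ p - q = (0, 1) ∨ p - q = (0, -1)

instance (p q : Cell) : Decidable (Adjacent p q) := by
  unfold Adjacent; infer_instance

/-- The black-to-white adjacency matrix of a set of cells, with respect to
labelings `β` of the black cells and `ω` of the white cells. -/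
def btwMatrix {S : Finset Cell} {b w : ℕ}
    (β : Fin b ≃ blackCells S) (ω : Fin w ≃ whiteCells S) :
    Matrix (Fin b) (Fin w) ℤ :=
  fun i j => if Adjacent (β i : Cell) (ω j : Cell) then 1 else 0

/-- A domino: an unordered pair of adjacent cells. -/
def IsDomino (d : Finset Cell) : Prop := ∃ p q : Cell, Adjacent p q ∧ d = {p, q}

/-- A domino tiling of `S`: a partition of `S` into dominoes. -/
def IsTiling (S : Finset Cell) (τ : Finset (Finset Cell)) : Prop :=
  (∀ d ∈ τ, IsDomino d) ∧ (∀ d ∈ τ, d ⊆ S) ∧ (∀ p ∈ S, ∃! d, d ∈ τ ∧ p ∈ d)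

/-- `π` is the permutation associated to the tiling `τ` via the labelings
`β`, `ω`: `π j = i` iff the `i`-th black cell and the `j`-th white cell form a
domino of `τ`. -/
def PermRepresents {S : Finset Cell} {n : ℕ}
    (β : Fin n ≃ blackCells S) (ω : Fin n ≃ whiteCells S)
    (τ : Finset (Finset Cell)) (π : Equiv.Perm (Fin n)) : Prop :=
  ∀ i j, π j = i ↔ ({(β i : Cell), (ω j : Cell)} : Finset Cell) ∈ τ

open scoped Classical in
/-- The sign of the permutation associated to a tiling `τ` via the labelings
`β`, `ω` (junk value `1` if no such permutation exists). -/
noncomputable def tilingSign {S : Finset Cell} {n : ℕ}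
    (β : Fin n ≃ blackCells S) (ω : Fin n ≃ whiteCells S)
    (τ : Finset (Finset Cell)) : ℤˣ :=
  if h : ∃ π : Equiv.Perm (Fin n), PermRepresents β ω τ π then
    Equiv.Perm.sign h.choose
  else 1


/-! ### Topological part -/

lemma exists_log_of_contractible {X : Type*} [TopologicalSpace X] [ContractibleSpace X]
    (f : C(X, {z : ℂ // z ≠ 0})) : ∃ g : C(X, ℂ), ∀ x, Complex.exp (g x) = (f x : ℂ) := by
  obtain ⟨y, ⟨F⟩⟩ := id_nullhomotopic X
  let F' := F.symm
  let H : C(unitInterval × X, {z : ℂ // z ≠ 0}) := f.comp F'.toContinuousMap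
  have hcov := Complex.isCoveringMap_exp
  have h0 : ∀ a, H (0, a) = (⟨_, (Complex.log (f y)).exp_ne_zero⟩ : {z : ℂ // z ≠ 0}) := by
    intro a
    apply Subtype.ext
    simp only [H, ContinuousMap.comp_apply]
    rw [Complex.exp_log (f y).2]
    congr 2
    exact F'.apply_zero a
  let G := hcov.liftHomotopy H (ContinuousMap.const X (Complex.log (f y))) h0
  refine ⟨G.comp ⟨fun x => (1, x), by fun_prop⟩, fun x => ?_⟩
  have := congrFun (hcov.liftHomotopy_lifts H (ContinuousMap.const X (Complex.log (f y))) h0) (1, x)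
  have h2 := congrArg Subtype.val this
  have h3 : H (1, x) = f x := by
    simp only [H, ContinuousMap.comp_apply]
    congr 1
    exact F'.apply_one x
  rw [h3] at h2
  exact h2

lemma isClosed_unitSquare (p : Cell) : IsClosed (unitSquare p) := isClosed_Icc.prod isClosed_Icc

lemma isClosed_Region (S : Finset Cell) : IsClosed (Region S) :=
  isClosed_biUnion_finset fun p _ => isClosed_unitSquare p

lemma isClosed_iUnion_unitSquare (C : Set Cell) : IsClosed (⋃ p : C, unitSquare p) := by
  apply LocallyFinite.isClosed_iUnion
  · rintro ⟨a, b⟩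
    refine ⟨Set.Ioo (a - 1) (a + 1) ×ˢ Set.Ioo (b - 1) (b + 1),
      prod_mem_nhds (Ioo_mem_nhds (by linarith) (by linarith))
        (Ioo_mem_nhds (by linarith) (by linarith)), ?_⟩
    apply Set.Finite.of_finite_image (f := Subtype.val) _ Subtype.val_injective.injOn
    apply Set.Finite.subset
      ((Set.finite_Icc (⌊a⌋ - 2) (⌊a⌋ + 2)).prod (Set.finite_Icc (⌊b⌋ - 2) (⌊b⌋ + 2)))
    rintro _ ⟨⟨⟨x, y⟩, hC⟩, ⟨⟨u, v⟩, huv⟩, rfl⟩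
    simp only [unitSquare, Set.mem_inter_iff, Set.mem_prod, Set.mem_Icc, Set.mem_Ioo] at huv
    obtain ⟨⟨⟨h1, h2⟩, h3, h4⟩, ⟨h5, h6⟩, h7, h8⟩ := huv
    have ha := Int.floor_le a
    have ha' := Int.lt_floor_add_one a
    have hb := Int.floor_le b
    have hb' := Int.lt_floor_add_one b
    have e1 : (⌊a⌋ : ℝ) - 2 ≤ x := by linarith
    have e2 : (x : ℝ) ≤ ⌊a⌋ + 2 := by linarith
    have e3 : (⌊b⌋ : ℝ) - 2 ≤ y := by linarith
    have e4 : (y : ℝ) ≤ ⌊b⌋ + 2 := by linarith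
    simp only [Set.mem_prod, Set.mem_Icc]
    exact ⟨⟨by exact_mod_cast e1, by exact_mod_cast e2⟩, by exact_mod_cast e3, by exact_mod_cast e4⟩
  · exact fun p => isClosed_unitSquare p

lemma coord_cases {x y : ℤ} {a : ℝ} (h1 : a ∈ Set.Icc (x : ℝ) (x + 1))
    (h2 : a ∈ Set.Icc (y : ℝ) (y + 1)) : x = y ∨ x = y + 1 ∨ x = y - 1 := by
  have e1 : (x : ℝ) ≤ y + 1 := h1.1.trans h2.2
  have e2 : (y : ℝ) ≤ x + 1 := h2.1.trans h1.2
  have e1' : x ≤ y + 1 := by exact_mod_cast e1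
  have e2' : y ≤ x + 1 := by exact_mod_cast e2
  omega

lemma no_bounded_component (S : Finset Cell) (hS : IsBoard S) (C : Set Cell) (hfin : C.Finite)
    (hdisj : ∀ p ∈ C, p ∉ S)
    (hadj : ∀ p ∈ C, ∀ q, Adjacent p q → q ∉ S → q ∈ C) : C = ∅ := by
  by_contra hne
  obtain ⟨p0, hp0⟩ := Set.nonempty_iff_ne_empty.mpr hne
  obtain ⟨-, ⟨e⟩⟩ := hS
  let K := Region S
  have hKc : IsClosed K := isClosed_Region S
  let Cf := hfin.toFinset
  let RC := Region Cf
  have hRCc : IsClosed RC := isClosed_Region Cf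
  let U : Set (ℝ × ℝ) := RC \ K
  have memR : ∀ (T : Finset Cell) z, z ∈ Region T ↔ ∃ p ∈ T, z ∈ unitSquare p := by
    intro T z; simp [Region]
  have hU : Uᶜ = K ∪ ⋃ p : (Cᶜ : Set Cell), unitSquare p := by
    ext ⟨a, b⟩
    constructor
    · intro h
      by_cases hK : (a, b) ∈ K
      · exact Or.inl hK
      right
      have h1 : (a, b) ∉ RC := fun h' => h ⟨h', hK⟩
      rw [Set.mem_iUnion]
      have hsq : (a, b) ∈ unitSquare (⌊a⌋, ⌊b⌋) :=
        ⟨⟨Int.floor_le a, (Int.lt_floor_add_one a).le⟩, ⟨Int.floor_le b, (Int.lt_floor_add_one b).le⟩⟩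
      exact ⟨⟨(⌊a⌋, ⌊b⌋), fun hc => h1 ((memR _ _).2 ⟨_, hfin.mem_toFinset.2 hc, hsq⟩)⟩, hsq⟩
    · rintro (h | h) hUz
      · exact hUz.2 h
      · rw [Set.mem_iUnion] at h
        obtain ⟨⟨⟨x, y⟩, hq⟩, hqz⟩ := h
        obtain ⟨⟨x', y'⟩, hp, hpz⟩ := (memR _ _).1 hUz.1
        have hp : (x', y') ∈ C := hfin.mem_toFinset.1 hp
        have key : ∀ r, (a, b) ∈ unitSquare r → r ∉ S := fun r hr hrS =>
          hUz.2 ((memR _ _).2 ⟨r, hrS, hr⟩)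
        have hr : (x', y) ∈ C := by
          have hrS := key (x', y) ⟨hpz.1, hqz.2⟩
          rcases coord_cases hpz.2 hqz.2 with h | h | h
          · simp only at h; rwa [← h]
          · exact hadj _ hp _ (by simp only at h; subst h; simp [Adjacent]) hrS
          · exact hadj _ hp _ (by simp only at h; subst h; simp [Adjacent]) hrS
        apply hq
        have hqS := key _ hqz
        rcases coord_cases hpz.1 hqz.1 with h | h | h
        · simp only at h; rwa [← h]
        · exact hadj _ hr _ (by simp only at h; subst h; simp [Adjacent]) hqS
        · exact hadj _ hr _ (by simp only at h; subst h; simp [Adjacent]) hqS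
  have hUo : IsOpen U := by
    rw [← isClosed_compl_iff, hU]
    exact hKc.union (isClosed_iUnion_unitSquare _)
  -- the centre point
  let c : ℝ × ℝ := ((p0.1 : ℝ) + 1 / 2, (p0.2 : ℝ) + 1 / 2)
  have hcsq : c ∈ unitSquare p0 := by
    simp only [unitSquare, Set.mem_prod, Set.mem_Icc, c]
    refine ⟨⟨?_, ?_⟩, ?_, ?_⟩ <;> linarith
  have hcU : c ∈ U := by
    by_contra hcon
    have : c ∈ Uᶜ := hcon
    rw [hU] at this
    have hkey : ∀ q, c ∈ unitSquare q → q = p0 := by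
      rintro ⟨x, y⟩ hq
      simp only [unitSquare, Set.mem_prod, Set.mem_Icc, c] at hq
      obtain ⟨⟨h1, h2⟩, h3, h4⟩ := hq
      have e1 : (x : ℝ) < p0.1 + 1 := by linarith
      have e2 : (p0.1 : ℝ) < x + 1 := by linarith
      have e3 : (y : ℝ) < p0.2 + 1 := by linarith
      have e4 : (p0.2 : ℝ) < y + 1 := by linarith
      have e1 : x < p0.1 + 1 := by exact_mod_cast e1
      have e2 : p0.1 < x + 1 := by exact_mod_cast e2
      have e3 : y < p0.2 + 1 := by exact_mod_cast e3
      have e4 : p0.2 < y + 1 := by exact_mod_cast e4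
      ext <;> simp only <;> omega
    rcases this with h | h
    · obtain ⟨q, hq, hqc⟩ := (memR _ _).1 h
      rw [hkey q hqc] at hq
      exact hdisj _ hp0 hq
    · rw [Set.mem_iUnion] at h
      obtain ⟨⟨q, hq⟩, hqc⟩ := h
      have := hkey q hqc
      subst this
      exact hq hp0
  have hcK : c ∉ K := hcU.2
  -- the complex coordinate centred at `c`
  let w : ℝ × ℝ → ℂ := fun z => ((z.1 - c.1 : ℝ) : ℂ) + ((z.2 - c.2 : ℝ) : ℂ) * Complex.I
  have hwc : Continuous w := by
    simp only [w]; fun_prop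
  have hw0 : ∀ z, w z = 0 → z = c := by
    intro z hz
    have h1 := congrArg Complex.re hz
    have h2 := congrArg Complex.im hz
    simp [w] at h1 h2
    ext <;> linarith
  -- logarithm on `K`
  haveI : ContractibleSpace (Metric.closedBall (0 : EuclideanSpace ℝ (Fin 2)) 1) :=
    (convex_closedBall _ _).contractibleSpace ⟨0, by simp⟩
  haveI : ContractibleSpace K := e.contractibleSpace
  obtain ⟨θ, hθ⟩ := exists_log_of_contractible
    (⟨fun z : K => (⟨w z, fun h => hcK (hw0 _ h ▸ z.2)⟩ : {z : ℂ // z ≠ 0}),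
      Continuous.subtype_mk (hwc.comp continuous_subtype_val) _⟩ : C(K, {z : ℂ // z ≠ 0}))
  obtain ⟨Θ, hΘ⟩ := ContinuousMap.exists_extension' hKc.isClosedEmbedding_subtypeVal θ
  have hΘK : ∀ z ∈ K, Complex.exp (Θ z) = w z := by
    intro z hz
    have h1 := congrFun hΘ ⟨z, hz⟩
    have h2 := hθ ⟨z, hz⟩
    simp only [Function.comp_apply] at h1
    rw [h1]; exact h2
  classical
  let F : ℝ × ℝ → ℂ := U.piecewise (fun z => Complex.exp (Θ z)) w
  have hFc : Continuous F := by
    apply Continuous.piecewise _ (by fun_prop) hwc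
    intro z hz
    apply hΘK
    have h1 : z ∈ closure U := frontier_subset_closure hz
    have h2 : z ∈ RC := (closure_minimal Set.diff_subset hRCc) h1
    by_contra h3
    rw [hUo.frontier_eq] at hz
    exact hz.2 ⟨h2, h3⟩
  have hF0 : ∀ z, F z ≠ 0 := by
    intro z
    by_cases hz : z ∈ U
    · simp only [F, Set.piecewise_eq_of_mem _ _ _ hz]; exact Complex.exp_ne_zero _
    · simp only [F, Set.piecewise_eq_of_notMem _ _ _ hz]
      intro h; exact hz (hw0 _ h ▸ hcU)
  obtain ⟨L, hL⟩ := exists_log_of_contractible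
    (⟨fun z => ⟨F z, hF0 z⟩, Continuous.subtype_mk hFc _⟩ : C(ℝ × ℝ, {z : ℂ // z ≠ 0}))
  -- large circle
  have hbdd : Bornology.IsBounded RC := by
    apply IsCompact.isBounded
    exact Cf.isCompact_biUnion fun p _ => isCompact_Icc.prod isCompact_Icc
  obtain ⟨R, hR0, hR⟩ := hbdd.subset_ball_lt 0 c
  let γ : ℝ → ℝ × ℝ := fun t => (c.1 + 2 * R * Real.cos t, c.2 + 2 * R * Real.sin t)
  have hγc : Continuous γ := by simp only [γ]; fun_prop
  have hγU : ∀ t, γ t ∉ U := by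
    intro t ht
    have h1 := hR ht.1
    rw [Metric.mem_ball, Prod.dist_eq, max_lt_iff, Real.dist_eq, Real.dist_eq] at h1
    simp only [γ, add_sub_cancel_left] at h1
    have h2 := sq_lt_sq' (abs_lt.1 h1.1).1 (abs_lt.1 h1.1).2
    have h3 := sq_lt_sq' (abs_lt.1 h1.2).1 (abs_lt.1 h1.2).2
    nlinarith [Real.sin_sq_add_cos_sq t]
  have hwγ : ∀ t, w (γ t) = (2 * R : ℝ) * Complex.exp (t * Complex.I) := by
    intro t
    simp only [w, γ, add_sub_cancel_left]
    rw [Complex.exp_mul_I]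
    push_cast
    ring
  have hLγ : ∀ t, Complex.exp (L (γ t)) = (2 * R : ℝ) * Complex.exp (t * Complex.I) := by
    intro t
    rw [hL, ← hwγ]
    show F (γ t) = _
    simp only [F, Set.piecewise_eq_of_notMem _ _ _ (hγU t)]
  have heq : (fun t : ℝ => L (γ t)) = fun t : ℝ => t * Complex.I + L (γ 0) := by
    apply Complex.isCoveringMap_exp.eq_of_comp_eq (by fun_prop) (by fun_prop) _ (0 : ℝ) (by simp)
    funext t
    apply Subtype.ext
    simp only [Function.comp_apply]
    rw [Complex.exp_add, hLγ, hLγ]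
    simp [mul_comm]
  have h2 := congrFun heq (2 * Real.pi)
  have hγ2 : γ (2 * Real.pi) = γ 0 := by simp [γ]
  simp only [hγ2] at h2
  have : ((2 * Real.pi : ℝ) : ℂ) * Complex.I = 0 := by
    have := sub_eq_zero.2 h2
    ring_nf at this ⊢
    simpa using this
  simp [Complex.I_ne_zero, Real.pi_ne_zero] at this

/-! ### Flows on finite directed graphs -/

/-- `φ` is a flow on the directed graph with finite arc set `E`, sources `s` and targets `t`. -/
def IsFlow {ι V A : Type} [DecidableEq V] [AddCommGroup A] (E : Finset ι) (s t : ι → V)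
    (φ : ι → A) : Prop :=
  ∀ v, ∑ e ∈ E, (if s e = v then φ e else 0) = ∑ e ∈ E, (if t e = v then φ e else 0)

lemma exists_int_flow {ι V A : Type} [DecidableEq ι] [DecidableEq V] [AddCommGroup A]
    (E : Finset ι) : ∀ (s t : ι → V) (φ : ι → A), IsFlow E s t φ → (∃ e ∈ E, φ e ≠ 0) →
    ∃ ψ : ι → ℤ, IsFlow E s t ψ ∧ ∃ e ∈ E, ψ e ≠ 0 := by
  induction E using Finset.induction_on with
  | empty => rintro s t φ - ⟨e, he, -⟩; simp at he
  | insert e E he ih =>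
    intro s t φ hφ hne
    by_cases hst : s e = t e
    · refine ⟨Pi.single e 1, ?_, e, Finset.mem_insert_self _ _, by simp⟩
      intro v
      apply Finset.sum_congr rfl
      intro e' _
      by_cases h : e' = e
      · subst h; rw [hst]
      · simp [Pi.single_eq_of_ne h]
    · set u := s e with hu
      set v := t e with hv
      let r : V → V := fun x => if x = v then u else x
      -- sums after contraction
      have hr : ∀ {A : Type} [AddCommGroup A] (f : ι → V) (φ : ι → A) (x : V),
          ∑ e ∈ E, (if r (f e) = x then φ e else 0) =
            if x = v then 0 else if x = u then
              ∑ e ∈ E, (if f e = u then φ e else 0) + ∑ e ∈ E, (if f e = v then φ e else 0)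
            else ∑ e ∈ E, (if f e = x then φ e else 0) := by
        intro A _ f φ x
        by_cases hxv : x = v
        · rw [if_pos hxv]
          apply Finset.sum_eq_zero
          intro e' _
          rw [if_neg]
          simp only [r]
          split_ifs with h
          · rw [hxv]; exact hst
          · rw [hxv]; exact h
        rw [if_neg hxv]
        by_cases hxu : x = u
        · rw [if_pos hxu, ← Finset.sum_add_distrib]
          apply Finset.sum_congr rfl
          intro e' _
          simp only [r, hxu]
          by_cases h : f e' = v
          · simp [h, Ne.symm hst]
          · simp [h]
        · rw [if_neg hxu]
          apply Finset.sum_congr rfl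
          intro e' _
          simp only [r]
          by_cases h : f e' = v
          · simp [h, Ne.symm hxu, Ne.symm hxv]
          · simp [h]
      have hK : ∀ x, (if u = x then φ e else 0) + ∑ e ∈ E, (if s e = x then φ e else 0) =
          (if v = x then φ e else 0) + ∑ e ∈ E, (if t e = x then φ e else 0) := by
        intro x
        have := hφ x
        rwa [Finset.sum_insert he, Finset.sum_insert he] at this
      obtain ⟨ψ, hψ, e1, he1, hψ1⟩ := ih (r ∘ s) (r ∘ t) φ (by
        intro x
        simp only [Function.comp_apply]
        rw [hr, hr]
        split_ifs with h1 h2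
        · rfl
        · have hKu := hK u
          have hKv := hK v
          simp only [if_true, if_neg hst, if_neg (Ne.symm hst), zero_add] at hKu hKv
          rw [hKv, ← hKu]; abel
        · have := hK x
          simpa [Ne.symm h1, Ne.symm h2] using this) (by
        by_contra hcon
        push Not at hcon
        have hKu := hK u
        have z : ∀ f : ι → V, ∑ e ∈ E, (if f e = u then φ e else 0) = 0 := by
          intro f
          apply Finset.sum_eq_zero
          intro e' he'
          simp [hcon e' he']
        rw [z, z] at hKu
        simp [Ne.symm hst] at hKu
        obtain ⟨e2, he2, h2⟩ := hne
        rcases Finset.mem_insert.1 he2 with h | h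
        · exact h2 (h ▸ hKu)
        · exact h2 (hcon _ h))
      let val : ℤ := ∑ e ∈ E, (if s e = v then ψ e else 0) - ∑ e ∈ E, (if t e = v then ψ e else 0)
      refine ⟨Function.update ψ e val, ?_, e1, Finset.mem_insert_of_mem he1, ?_⟩
      · intro x
        have hup : ∀ f : ι → V, ∑ e' ∈ E, (if f e' = x then Function.update ψ e val e' else 0) =
            ∑ e' ∈ E, (if f e' = x then ψ e' else 0) := by
          intro f
          apply Finset.sum_congr rfl
          intro e' he'
          rw [Function.update_of_ne]
          rintro rfl; exact he he'
        rw [Finset.sum_insert he, Finset.sum_insert he, hup, hup, Function.update_self]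
        rw [← hu, ← hv]
        have hx := hψ x
        have hxu := hψ u
        simp only [Function.comp_apply] at hx hxu
        rw [hr, hr] at hx hxu
        by_cases hxv : x = v
        · subst hxv
          simp [hst, val]
        · by_cases hxu' : x = u
          · subst hxu'
            simp [hst, Ne.symm hst] at hxu ⊢
            simp only [val]
            linarith
          · simpa [hxv, hxu', Ne.symm hxv, Ne.symm hxu'] using hx
      · rw [Function.update_of_ne]
        · exact hψ1
        · rintro rfl; exact he he1

lemma sum_fiber_three {ι V A : Type} [DecidableEq ι] [DecidableEq V] [AddCommGroup A]
    (E : Finset ι) (s : ι → V) (φ : ι → A) (hφ : ∀ e ∉ E, φ e = 0) (v : V) (e1 e2 e3 : ι)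
    (h : ∀ e, s e = v ↔ e = e1 ∨ e = e2 ∨ e = e3) (h12 : e1 ≠ e2) (h13 : e1 ≠ e3) (h23 : e2 ≠ e3) :
    ∑ e ∈ E, (if s e = v then φ e else 0) = φ e1 + φ e2 + φ e3 := by
  have h1 : ∑ e ∈ E, (if s e = v then φ e else 0) =
      ∑ e ∈ E ∪ {e1, e2, e3}, (if s e = v then φ e else 0) := by
    apply Finset.sum_subset Finset.subset_union_left
    intro x _ hx
    simp [hφ x hx]
  have h2 : ∑ e ∈ ({e1, e2, e3} : Finset ι), (if s e = v then φ e else 0) =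
      ∑ e ∈ E ∪ {e1, e2, e3}, (if s e = v then φ e else 0) := by
    apply Finset.sum_subset Finset.subset_union_right
    intro x _ hx
    rw [if_neg]
    rw [h]
    simpa using hx
  rw [h1, ← h2, Finset.sum_insert (by simp [h12, h13]), Finset.sum_insert (by simp [h23]),
    Finset.sum_singleton, if_pos ((h _).2 (by simp)), if_pos ((h _).2 (by simp)),
    if_pos ((h _).2 (by simp)), add_assoc]

/-! ### The arcs -/

/-- Source of an arc. -/
def arcSrc : (ℤ × ℤ) × Fin 6 → (ℤ × ℤ) × Bool
  | ((i, j), 0) => ((i, j), true)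
  | ((i, j), 1) => ((i, j + 1), false)
  | ((i, j), 2) => ((i, j), false)
  | ((i, j), 3) => ((i + 1, j), true)
  | ((i, j), 4) => ((i, j), true)
  | ((i, j), 5) => ((i, j + 1), false)

/-- Target of an arc. -/
def arcTgt : (ℤ × ℤ) × Fin 6 → (ℤ × ℤ) × Bool
  | ((i, j), 0) => ((i + 1, j), true)
  | ((i, j), 1) => ((i, j), false)
  | ((i, j), 2) => ((i, j), true)
  | ((i, j), 3) => ((i, j), false)
  | ((i, j), 4) => ((i, j + 1), false)
  | ((i, j), 5) => ((i + 1, j), true)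

lemma arcSrc_true (i j : ℤ) (e) : arcSrc e = ((i, j), true) ↔
    e = ((i, j), 0) ∨ e = ((i, j), 4) ∨ e = ((i - 1, j), 3) := by
  obtain ⟨⟨x, y⟩, k⟩ := e
  fin_cases k <;> simp [arcSrc] <;> omega

lemma arcTgt_true (i j : ℤ) (e) : arcTgt e = ((i, j), true) ↔
    e = ((i - 1, j), 0) ∨ e = ((i - 1, j), 5) ∨ e = ((i, j), 2) := by
  obtain ⟨⟨x, y⟩, k⟩ := e
  fin_cases k <;> simp [arcTgt] <;> omega

lemma arcSrc_false (i j : ℤ) (e) : arcSrc e = ((i, j), false) ↔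
    e = ((i, j), 2) ∨ e = ((i, j - 1), 1) ∨ e = ((i, j - 1), 5) := by
  obtain ⟨⟨x, y⟩, k⟩ := e
  fin_cases k <;> simp [arcSrc] <;> omega

lemma arcTgt_false (i j : ℤ) (e) : arcTgt e = ((i, j), false) ↔
    e = ((i, j), 1) ∨ e = ((i, j), 3) ∨ e = ((i, j - 1), 4) := by
  obtain ⟨⟨x, y⟩, k⟩ := e
  fin_cases k <;> simp [arcTgt] <;> omega

lemma isFlow_arc_iff {A : Type} [AddCommGroup A] (E : Finset ((ℤ × ℤ) × Fin 6))
    (φ : (ℤ × ℤ) × Fin 6 → A) (hφ : ∀ e ∉ E, φ e = 0) :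
    IsFlow E arcSrc arcTgt φ ↔ ∀ i j : ℤ,
      (φ ((i, j), 0) + φ ((i, j), 4) + φ ((i - 1, j), 3) =
        φ ((i - 1, j), 0) + φ ((i - 1, j), 5) + φ ((i, j), 2)) ∧
      (φ ((i, j), 2) + φ ((i, j - 1), 1) + φ ((i, j - 1), 5) =
        φ ((i, j), 1) + φ ((i, j), 3) + φ ((i, j - 1), 4)) := by
  have e1 : ∀ i j : ℤ, _ := fun i j => sum_fiber_three E arcSrc φ hφ ((i, j), true) _ _ _
    (arcSrc_true i j) (by simp) (by simp) (by simp)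
  have e2 : ∀ i j : ℤ, _ := fun i j => sum_fiber_three E arcTgt φ hφ ((i, j), true) _ _ _
    (arcTgt_true i j) (by simp) (by simp) (by simp)
  have e3 : ∀ i j : ℤ, _ := fun i j => sum_fiber_three E arcSrc φ hφ ((i, j), false) _ _ _
    (arcSrc_false i j) (by simp) (by simp) (by simp)
  have e4 : ∀ i j : ℤ, _ := fun i j => sum_fiber_three E arcTgt φ hφ ((i, j), false) _ _ _
    (arcTgt_false i j) (by simp) (by simp) (by simp)
  constructor
  · intro h i j
    rw [← e1, ← e2, ← e3, ← e4]
    exact ⟨h _, h _⟩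
  · rintro h ⟨⟨i, j⟩, b⟩
    cases b
    · rw [e3, e4]; exact (h i j).2
    · rw [e1, e2]; exact (h i j).1

/-- Discrete integration of a finitely supported closed form on `ℤ²`. -/
lemma exists_potential (TH TV : ℤ → ℤ → ℤ) (N : ℤ)
    (hTH : ∀ i j, (N < |i| ∨ N < |j|) → TH i j = 0)
    (hTV : ∀ i j, (N < |i| ∨ N < |j|) → TV i j = 0)
    (hcl : ∀ i j, TV (i + 1) j - TV i j = TH i (j + 1) - TH i j) :
    ∃ g : ℤ → ℤ → ℤ, (∀ i j, g (i + 1) j - g i j = TH i j) ∧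
      (∀ i j, g i (j + 1) - g i j = TV i j) ∧
      ∀ i j, (N + 1 < |i| ∨ N + 1 < |j|) → g i j = 0 := by
  let g : ℤ → ℤ → ℤ := fun i j => ∑ k ∈ Finset.Ico (-N - 1) i, TH k j
  have hstep : ∀ i j, g (i + 1) j - g i j = TH i j := by
    intro i j
    simp only [g]
    by_cases h : -N - 1 ≤ i
    · rw [← Finset.insert_Ico_right_eq_Ico_add_one h, Finset.sum_insert (by simp)]; ring
    · rw [Finset.Ico_eq_empty (by omega), Finset.Ico_eq_empty (by omega)]
      rw [hTH]
      · simp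
      · left; rw [lt_abs]; right; omega
  have hneg : ∀ i j, i ≤ -N - 1 → g i j = 0 := by
    intro i j h
    simp only [g]
    rw [Finset.Ico_eq_empty (by omega)]; simp
  have hV : ∀ i j, g i (j + 1) - g i j = TV i j := by
    intro i j
    rcases le_total (-N - 1) i with h | h
    · induction i, h using Int.leInduction with
      | base =>
        rw [hneg _ _ le_rfl, hneg _ _ le_rfl, hTV]
        · simp
        · left; rw [lt_abs]; right; omega
      | succ i h ih =>
        have := hstep i j
        have := hstep i (j + 1)
        have := hcl i j
        linarith
    · rw [hneg _ _ h, hneg _ _ h, hTV]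
      · simp
      · left; rw [lt_abs]; right; omega
  have hj : ∀ i j, N < |j| → g i j = 0 := by
    intro i j h
    simp only [g]
    exact Finset.sum_eq_zero fun k _ => hTH _ _ (Or.inr h)
  refine ⟨g, hstep, hV, ?_⟩
  rintro i j (h | h)
  · rcases lt_abs.1 h with h | h
    · -- far right: constant in j
      have hc : ∀ j, g i (j + 1) = g i j := by
        intro j
        have := hV i j
        rw [hTV i j (Or.inl (lt_abs.2 (Or.inl (by omega))))] at this
        linarith
      have hc' : ∀ n : ℕ, g i (j + n) = g i j := by
        intro n
        induction n with
        | zero => simp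
        | succ n ih => rw [Nat.cast_succ, ← add_assoc, hc, ih]
      rw [← hc' (N.natAbs + j.natAbs + 1)]
      apply hj
      rw [lt_abs]
      left
      push_cast
      have := neg_abs_le j
      have := le_abs_self N
      omega
    · exact hneg _ _ (by omega)
  · exact hj _ _ (by omega)

/-- Solutions of the discrete wave equation on the white cells. -/
def IsWave {A : Type} [AddCommGroup A] (Bk Wh : Finset (ℤ × ℤ)) (g : ℤ → ℤ → A) : Prop :=
  (∀ i j, (i, j) ∉ Wh → g i j = 0) ∧
    ∀ i j, (i, j) ∈ Bk → g i j + g (i + 1) (j + 1) = g (i + 1) j + g i (j + 1)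

lemma exists_bound (T : Finset (ℤ × ℤ)) : ∃ N : ℤ, 0 ≤ N ∧ ∀ i j, (i, j) ∈ T → |i| ≤ N ∧ |j| ≤ N := by
  induction T using Finset.induction_on with
  | empty => exact ⟨0, le_rfl, by simp⟩
  | insert a T _ ih =>
    obtain ⟨N, h0, hN⟩ := ih
    refine ⟨max N (max |a.1| |a.2|), by simp [h0], ?_⟩
    intro i j h
    rcases Finset.mem_insert.1 h with h | h
    · subst h; simp
    · have := hN i j h
      simp [this.1, this.2]

/-- Which arcs are present. -/
def ArcActive (Bk Wh : Finset (ℤ × ℤ)) : (ℤ × ℤ) × Fin 6 → Prop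
  | ((i, j), 0) => (i, j) ∈ Bk
  | ((i, j), 1) => (i, j) ∈ Bk
  | ((i, j), 2) => (i, j) ∉ Bk ∧ (i, j) ∈ Wh
  | ((i, j), 3) => (i, j) ∉ Bk ∧ (i + 1, j) ∈ Wh
  | ((i, j), 4) => (i, j) ∉ Bk ∧ (i, j + 1) ∈ Wh
  | ((i, j), 5) => (i, j) ∉ Bk ∧ (i + 1, j + 1) ∈ Wh

/-- The flow associated to a wave. -/
noncomputable def waveFlow {A : Type} [AddCommGroup A] (Bk : Finset (ℤ × ℤ)) (g : ℤ → ℤ → A) :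
    (ℤ × ℤ) × Fin 6 → A
  | ((i, j), 0) => if (i, j) ∈ Bk then g i (j + 1) - g i j else 0
  | ((i, j), 1) => if (i, j) ∈ Bk then g (i + 1) j - g i j else 0
  | ((i, j), 2) => if (i, j) ∈ Bk then 0 else g i j
  | ((i, j), 3) => if (i, j) ∈ Bk then 0 else g (i + 1) j
  | ((i, j), 4) => if (i, j) ∈ Bk then 0 else g i (j + 1)
  | ((i, j), 5) => if (i, j) ∈ Bk then 0 else g (i + 1) (j + 1)

lemma exists_int_wave {A : Type} [AddCommGroup A] (Bk Wh : Finset (ℤ × ℤ))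
    (hT : ∀ gW gB : ℤ → ℤ → ℤ,
      (∃ N : ℤ, ∀ i j, (N < |i| ∨ N < |j|) → gW i j = 0 ∧ gB i j = 0) →
      (∀ i j, (i, j) ∉ Bk →
        ((i, j) ∉ Wh → gW i j = gB i j) ∧ ((i + 1, j) ∉ Wh → gW (i + 1) j = gB i j) ∧
        ((i, j + 1) ∉ Wh → gW i (j + 1) = gB i j) ∧
        ((i + 1, j + 1) ∉ Wh → gW (i + 1) (j + 1) = gB i j)) →
      (∀ i j, (i, j) ∉ Wh → gW i j = 0) ∧ (∀ i j, (i, j) ∉ Bk → gB i j = 0))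
    (g : ℤ → ℤ → A) (hg : IsWave Bk Wh g) (hne : ∃ i j, g i j ≠ 0) :
    ∃ g' : ℤ → ℤ → ℤ, IsWave Bk Wh g' ∧ ∃ i j, g' i j ≠ 0 := by
  classical
  obtain ⟨N, hN0, hN⟩ := exists_bound (Bk ∪ Wh)
  have hNB : ∀ i j, (i, j) ∈ Bk → |i| ≤ N ∧ |j| ≤ N := fun i j h =>
    hN i j (Finset.mem_union_left _ h)
  have hNW : ∀ i j, (i, j) ∈ Wh → |i| ≤ N ∧ |j| ≤ N := fun i j h =>
    hN i j (Finset.mem_union_right _ h)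
  let E : Finset ((ℤ × ℤ) × Fin 6) :=
    (((Finset.Icc (-N - 1) (N + 1)) ×ˢ (Finset.Icc (-N - 1) (N + 1))) ×ˢ Finset.univ).filter
      (ArcActive Bk Wh)
  have hE : ∀ e, e ∈ E ↔ ArcActive Bk Wh e := by
    rintro ⟨⟨i, j⟩, k⟩
    simp only [E, Finset.mem_filter, Finset.mem_product, Finset.mem_univ, and_true,
      Finset.mem_Icc, and_iff_right_iff_imp]
    intro h
    have : (|i| ≤ N + 1) ∧ (|j| ≤ N + 1) := by
      have hb := hNB i j
      have hw1 := hNW i j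
      have hw2 := hNW (i + 1) j
      have hw3 := hNW i (j + 1)
      have hw4 := hNW (i + 1) (j + 1)
      simp only [abs_le] at *
      fin_cases k <;> simp only [ArcActive] at h
      · have := hb h; omega
      · have := hb h; omega
      · have := hw1 h.2; omega
      · have := hw2 h.2; omega
      · have := hw3 h.2; omega
      · have := hw4 h.2; omega
    simp only [abs_le] at this
    omega
  have hEbd : ∀ i j k, (N + 1 < |i| ∨ N + 1 < |j|) → ((i, j), k) ∉ E := by
    intro i j k h hmem
    simp only [E, Finset.mem_filter, Finset.mem_product, Finset.mem_Icc] at hmem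
    have h1 : |i| ≤ N + 1 := abs_le.2 (by omega)
    have h2 : |j| ≤ N + 1 := abs_le.2 (by omega)
    omega
  -- the flow over `A`
  obtain ⟨ψ0, hψ0, hψne⟩ := exists_int_flow E arcSrc arcTgt (waveFlow Bk g) (by
      rw [isFlow_arc_iff]
      · intro i j
        have w1 := hg.2 i j
        have w2 := hg.2 (i - 1) j
        have w3 := hg.2 i (j - 1)
        simp only [sub_add_cancel] at w2 w3
        simp only [waveFlow, sub_add_cancel]
        constructor
        · by_cases h1 : (i, j) ∈ Bk <;> by_cases h2 : (i - 1, j) ∈ Bk <;>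
            simp only [h1, h2, if_true, if_false, true_imp_iff] at w1 w2 ⊢
          · have := sub_eq_zero.2 w2
            first
              | (refine sub_eq_zero.1 (Eq.trans ?_ this); abel; done)
              | (refine sub_eq_zero.1 (neg_eq_zero.1 (Eq.trans ?_ this)); abel; done)
          · abel
          · have := sub_eq_zero.2 w2
            first
              | (refine sub_eq_zero.1 (Eq.trans ?_ this); abel; done)
              | (refine sub_eq_zero.1 (neg_eq_zero.1 (Eq.trans ?_ this)); abel; done)
        · by_cases h1 : (i, j) ∈ Bk <;> by_cases h2 : (i, j - 1) ∈ Bk <;>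
            simp only [h1, h2, if_true, if_false, true_imp_iff] at w1 w3 ⊢
          · have := sub_eq_zero.2 w3
            first
              | (refine sub_eq_zero.1 (Eq.trans ?_ this); abel; done)
              | (refine sub_eq_zero.1 (neg_eq_zero.1 (Eq.trans ?_ this)); abel; done)
          · abel
          · have := sub_eq_zero.2 w3
            first
              | (refine sub_eq_zero.1 (Eq.trans ?_ this); abel; done)
              | (refine sub_eq_zero.1 (neg_eq_zero.1 (Eq.trans ?_ this)); abel; done)
          · abel
      · rintro ⟨⟨i, j⟩, k⟩ he
        rw [hE] at he
        have hz := hg.1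
        fin_cases k <;> simp only [ArcActive, not_and, not_not] at he <;> simp [waveFlow]
        · intro h; exact absurd h he
        · intro h; exact absurd h he
        · intro h; exact hz _ _ (he h)
        · intro h; exact hz _ _ (he h)
        · intro h; exact hz _ _ (he h)
        · intro h; exact hz _ _ (he h)) (by
      by_contra hcon
      push Not at hcon
      have hz := hg.1
      have hconst : ∀ i j, g (i + 1) j = g i j := by
        intro i j
        by_cases hB : (i, j) ∈ Bk
        · have := hcon ((i, j), 1) ((hE _).2 hB)
          simp only [waveFlow, if_pos hB] at this
          exact sub_eq_zero.1 this
        · have h1 : g i j = 0 := by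
            by_cases hW : (i, j) ∈ Wh
            · have := hcon ((i, j), 2) ((hE _).2 ⟨hB, hW⟩)
              simpa only [waveFlow, if_neg hB] using this
            · exact hz _ _ hW
          have h2 : g (i + 1) j = 0 := by
            by_cases hW : (i + 1, j) ∈ Wh
            · have := hcon ((i, j), 3) ((hE _).2 ⟨hB, hW⟩)
              simpa only [waveFlow, if_neg hB] using this
            · exact hz _ _ hW
          rw [h1, h2]
      obtain ⟨i, j, hij⟩ := hne
      have hc' : ∀ n : ℕ, g (i + n) j = g i j := by
        intro n
        induction n with
        | zero => simp
        | succ n ih => rw [Nat.cast_succ, ← add_assoc, hconst, ih]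
      apply hij
      rw [← hc' (N.natAbs + i.natAbs + 1)]
      apply hz
      intro hmem
      have := (abs_le.1 (hNW _ _ hmem).1).2
      push_cast at this
      have := neg_abs_le i
      have := le_abs_self N
      omega)
  let ψ : (ℤ × ℤ) × Fin 6 → ℤ := fun e => if e ∈ E then ψ0 e else 0
  have hψE : ∀ e ∉ E, ψ e = 0 := fun e he => by simp [ψ, he]
  have hψfl : IsFlow E arcSrc arcTgt ψ := by
    intro v
    have := hψ0 v
    have hh : ∀ f : (ℤ × ℤ) × Fin 6 → (ℤ × ℤ) × Bool, ∑ e ∈ E, (if f e = v then ψ e else 0) =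
        ∑ e ∈ E, (if f e = v then ψ0 e else 0) := by
      intro f
      apply Finset.sum_congr rfl
      intro e he
      simp [ψ, he]
    rw [hh, hh, this]
  have hψne : ∃ e, ψ e ≠ 0 := by
    obtain ⟨e, he, h⟩ := hψne
    exact ⟨e, by simp only [ψ, if_pos he]; exact h⟩
  rw [isFlow_arc_iff E ψ hψE] at hψfl
  have hbd : ∀ i j k, (N + 1 < |i| ∨ N + 1 < |j|) → ψ ((i, j), k) = 0 := fun i j k h =>
    hψE _ (hEbd i j k h)
  let TV : ℤ → ℤ → ℤ := fun i j => ψ ((i, j), 0) + ψ ((i, j), 4) - ψ ((i, j), 2)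
  let TH : ℤ → ℤ → ℤ := fun i j => ψ ((i, j), 1) + ψ ((i, j), 3) - ψ ((i, j), 2)
  have hTV' : ∀ i j, TV (i + 1) j = ψ ((i, j), 0) + ψ ((i, j), 5) - ψ ((i, j), 3) := by
    intro i j
    have := (hψfl (i + 1) j).1
    simp only [add_sub_cancel_right] at this
    simp only [TV]
    linarith
  have hTH' : ∀ i j, TH i (j + 1) = ψ ((i, j), 1) + ψ ((i, j), 5) - ψ ((i, j), 4) := by
    intro i j
    have := (hψfl i (j + 1)).2
    simp only [add_sub_cancel_right] at this
    simp only [TH]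
    linarith
  obtain ⟨G, hGH, hGV, hG0⟩ := exists_potential TH TV (N + 1)
    (fun i j h => by simp [TH, hbd i j _ h]) (fun i j h => by simp [TV, hbd i j _ h])
    (fun i j => by rw [hTV', hTH']; simp only [TV, TH]; ring)
  have hBk : ∀ i j, (i, j) ∈ Bk → ψ ((i, j), 2) = 0 ∧ ψ ((i, j), 3) = 0 ∧ ψ ((i, j), 4) = 0 ∧
      ψ ((i, j), 5) = 0 := by
    intro i j h
    refine ⟨?_, ?_, ?_, ?_⟩ <;> apply hψE <;> rw [hE] <;> simp [ArcActive, h]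
  have hnBk : ∀ i j, (i, j) ∉ Bk → ψ ((i, j), 0) = 0 ∧ ψ ((i, j), 1) = 0 := by
    intro i j h
    refine ⟨?_, ?_⟩ <;> apply hψE <;> rw [hE] <;> simp [ArcActive, h]
  have hnW2 : ∀ i j, (i, j) ∉ Wh → ψ ((i, j), 2) = 0 := by
    intro i j h; apply hψE; rw [hE]; simp [ArcActive, h]
  have hnW3 : ∀ i j, (i + 1, j) ∉ Wh → ψ ((i, j), 3) = 0 := by
    intro i j h; apply hψE; rw [hE]; simp [ArcActive, h]
  have hnW4 : ∀ i j, (i, j + 1) ∉ Wh → ψ ((i, j), 4) = 0 := by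
    intro i j h; apply hψE; rw [hE]; simp [ArcActive, h]
  have hnW5 : ∀ i j, (i + 1, j + 1) ∉ Wh → ψ ((i, j), 5) = 0 := by
    intro i j h; apply hψE; rw [hE]; simp [ArcActive, h]
  let gB : ℤ → ℤ → ℤ := fun i j => if (i, j) ∈ Bk then 0 else G i j - ψ ((i, j), 2)
  -- values around a face outside the board
  have hface : ∀ i j, (i, j) ∉ Bk → G i j = gB i j + ψ ((i, j), 2) ∧
      G (i + 1) j = gB i j + ψ ((i, j), 3) ∧ G i (j + 1) = gB i j + ψ ((i, j), 4) ∧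
      G (i + 1) (j + 1) = gB i j + ψ ((i, j), 5) := by
    intro i j h
    have a1 := hGH i j
    have a2 := hGV i j
    have a3 := hGV (i + 1) j
    rw [hTV'] at a3
    obtain ⟨z0, z1⟩ := hnBk i j h
    simp only [gB, if_neg h, TV, TH, z0, z1] at a1 a2 a3 ⊢
    refine ⟨?_, ?_, ?_, ?_⟩ <;> linarith
  obtain ⟨hGW, hGB⟩ := hT G gB ⟨N + 1 + 1, fun i j h => ⟨hG0 i j h, by
      simp only [gB]
      rw [hG0 i j h, hbd i j 2 (by omega)]; simp⟩⟩ (by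
      intro i j h
      obtain ⟨f1, f2, f3, f4⟩ := hface i j h
      refine ⟨fun hw => ?_, fun hw => ?_, fun hw => ?_, fun hw => ?_⟩
      · rw [f1, hnW2 _ _ hw, add_zero]
      · rw [f2, hnW3 _ _ hw, add_zero]
      · rw [f3, hnW4 _ _ hw, add_zero]
      · rw [f4, hnW5 _ _ hw, add_zero])
  refine ⟨G, ⟨hGW, ?_⟩, ?_⟩
  · intro i j h
    have a2 := hGV i j
    have a3 := hGV (i + 1) j
    rw [hTV'] at a3
    obtain ⟨z2, z3, z4, z5⟩ := hBk i j h
    simp only [TV, z2, z3, z4, z5] at a2 a3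
    linarith
  · by_contra hcon
    push Not at hcon
    obtain ⟨⟨⟨i, j⟩, k⟩, hk⟩ := hψne
    apply hk
    by_cases h : (i, j) ∈ Bk
    · obtain ⟨z2, z3, z4, z5⟩ := hBk i j h
      have a1 := hGH i j
      have a2 := hGV i j
      simp only [TV, TH, hcon, z2, z3, z4] at a1 a2
      fin_cases k <;> simp only [Fin.isValue] <;> first | assumption | skip
      · show ψ ((i, j), 0) = 0
        linarith
      · show ψ ((i, j), 1) = 0
        linarith
    · obtain ⟨f1, f2, f3, f4⟩ := hface i j h
      obtain ⟨z0, z1⟩ := hnBk i j h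
      simp only [hcon, hGB i j h, zero_add] at f1 f2 f3 f4
      fin_cases k
      · exact z0
      · exact z1
      · exact f1.symm
      · exact f2.symm
      · exact f3.symm
      · exact f4.symm

/-! ### Coordinates -/

/-- The white cell with diagonal coordinates `(i, j)`. -/
def wc (i j : ℤ) : Cell := (i - j, i + j + 1)

/-- The black cell with diagonal coordinates `(i, j)`. -/
def bc (i j : ℤ) : Cell := (i - j, i + j + 2)

lemma wc_white (i j : ℤ) : ¬ IsBlackCell (wc i j) := by
  simp only [IsBlackCell, wc, Int.not_even_iff_odd]
  exact ⟨i, by ring⟩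

lemma bc_black (i j : ℤ) : IsBlackCell (bc i j) := ⟨i + 1, by simp only [bc]; ring⟩

lemma exists_wc {p : Cell} (hp : ¬ IsBlackCell p) : ∃ i j, p = wc i j := by
  obtain ⟨x, y⟩ := p
  simp only [IsBlackCell, Int.not_even_iff_odd] at hp
  obtain ⟨k, hk⟩ := hp
  exact ⟨k, k - x, by simp only [wc, Prod.mk.injEq]; omega⟩

lemma exists_bc {p : Cell} (hp : IsBlackCell p) : ∃ i j, p = bc i j := by
  obtain ⟨x, y⟩ := p
  obtain ⟨k, hk⟩ := hp
  simp only at hk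
  exact ⟨k - 1, k - 1 - x, by simp only [bc, Prod.mk.injEq]; omega⟩

lemma wc_inj {i j i' j' : ℤ} (h : wc i j = wc i' j') : i = i' ∧ j = j' := by
  simp only [wc, Prod.mk.injEq] at h; omega

lemma bc_inj {i j i' j' : ℤ} (h : bc i j = bc i' j') : i = i' ∧ j = j' := by
  simp only [bc, Prod.mk.injEq] at h; omega

lemma adj_bc (i j : ℤ) (q : Cell) : Adjacent (bc i j) q ↔
    q = wc i j ∨ q = wc (i + 1) (j + 1) ∨ q = wc (i + 1) j ∨ q = wc i (j + 1) := by
  obtain ⟨x, y⟩ := q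
  simp only [Adjacent, bc, wc, Prod.mk_sub_mk, Prod.mk.injEq]
  omega

lemma adj_wc (i j : ℤ) (q : Cell) : Adjacent (wc i j) q ↔
    q = bc i j ∨ q = bc (i - 1) (j - 1) ∨ q = bc (i - 1) j ∨ q = bc i (j - 1) := by
  obtain ⟨x, y⟩ := q
  simp only [Adjacent, bc, wc, Prod.mk_sub_mk, Prod.mk.injEq]
  omega

lemma adj_symm {p q : Cell} (h : Adjacent p q) : Adjacent q p := by
  obtain ⟨x, y⟩ := p
  obtain ⟨x', y'⟩ := q
  simp only [Adjacent, Prod.mk_sub_mk, Prod.mk.injEq] at *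
  omega

lemma exists_diag_finsets (S : Finset Cell) : ∃ Bk Wh : Finset (ℤ × ℤ),
    (∀ i j, (i, j) ∈ Bk ↔ bc i j ∈ S) ∧ (∀ i j, (i, j) ∈ Wh ↔ wc i j ∈ S) := by
  classical
  have h1 : Set.InjOn (fun p : ℤ × ℤ => bc p.1 p.2)
      ((fun p : ℤ × ℤ => bc p.1 p.2) ⁻¹' (S : Set Cell)) := by
    rintro ⟨a, b⟩ - ⟨c, d⟩ - h
    simpa using bc_inj h
  have h2 : Set.InjOn (fun p : ℤ × ℤ => wc p.1 p.2)
      ((fun p : ℤ × ℤ => wc p.1 p.2) ⁻¹' (S : Set Cell)) := by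
    rintro ⟨a, b⟩ - ⟨c, d⟩ - h
    simpa using wc_inj h
  exact ⟨S.preimage _ h1, S.preimage _ h2, fun i j => Finset.mem_preimage,
    fun i j => Finset.mem_preimage⟩

lemma board_hT (S : Finset Cell) (hS : IsBoard S) (Bk Wh : Finset (ℤ × ℤ))
    (hB : ∀ i j, (i, j) ∈ Bk ↔ bc i j ∈ S) (hW : ∀ i j, (i, j) ∈ Wh ↔ wc i j ∈ S)
    (gW gB : ℤ → ℤ → ℤ)
    (hfin : ∃ N : ℤ, ∀ i j, (N < |i| ∨ N < |j|) → gW i j = 0 ∧ gB i j = 0)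
    (h : ∀ i j, (i, j) ∉ Bk →
        ((i, j) ∉ Wh → gW i j = gB i j) ∧ ((i + 1, j) ∉ Wh → gW (i + 1) j = gB i j) ∧
        ((i, j + 1) ∉ Wh → gW i (j + 1) = gB i j) ∧
        ((i + 1, j + 1) ∉ Wh → gW (i + 1) (j + 1) = gB i j)) :
    (∀ i j, (i, j) ∉ Wh → gW i j = 0) ∧ (∀ i j, (i, j) ∉ Bk → gB i j = 0) := by
  simp only [hB, hW] at h ⊢
  let C : Set Cell := {p | p ∉ S ∧ ((∃ i j, p = wc i j ∧ gW i j ≠ 0) ∨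
    (∃ i j, p = bc i j ∧ gB i j ≠ 0))}
  have hC : C = ∅ := by
    apply no_bounded_component S hS C
    · obtain ⟨N, hN⟩ := hfin
      let box : Set (ℤ × ℤ) := Set.Icc (-N) N ×ˢ Set.Icc (-N) N
      have hbox : box.Finite := (Set.finite_Icc _ _).prod (Set.finite_Icc _ _)
      have hmem : ∀ i j, ¬ (N < |i| ∨ N < |j|) → (i, j) ∈ box := by
        intro i j h
        push Not at h
        exact ⟨abs_le.1 h.1, abs_le.1 h.2⟩
      apply ((hbox.image fun p => wc p.1 p.2).union (hbox.image fun p => bc p.1 p.2)).subset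
      rintro p ⟨-, ⟨i, j, rfl, hne⟩ | ⟨i, j, rfl, hne⟩⟩
      · exact Or.inl ⟨(i, j), hmem i j fun hc => hne (hN i j hc).1, rfl⟩
      · exact Or.inr ⟨(i, j), hmem i j fun hc => hne (hN i j hc).2, rfl⟩
    · exact fun p hp => hp.1
    · rintro p ⟨hpS, ⟨i, j, rfl, hne⟩ | ⟨i, j, rfl, hne⟩⟩ q hq hqS
      · refine ⟨hqS, Or.inr ?_⟩
        rcases (adj_wc i j q).1 hq with rfl | rfl | rfl | rfl
        · exact ⟨_, _, rfl, by rwa [← (h _ _ hqS).1 hpS]⟩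
        · have := (h _ _ hqS).2.2.2
          simp only [sub_add_cancel] at this
          exact ⟨_, _, rfl, by rwa [← this hpS]⟩
        · have := (h _ _ hqS).2.1
          simp only [sub_add_cancel] at this
          exact ⟨_, _, rfl, by rwa [← this hpS]⟩
        · have := (h _ _ hqS).2.2.1
          simp only [sub_add_cancel] at this
          exact ⟨_, _, rfl, by rwa [← this hpS]⟩
      · refine ⟨hqS, Or.inl ?_⟩
        obtain ⟨h1, h2, h3, h4⟩ := h i j hpS
        rcases (adj_bc i j q).1 hq with rfl | rfl | rfl | rfl
        · exact ⟨_, _, rfl, by rwa [h1 hqS]⟩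
        · exact ⟨_, _, rfl, by rwa [h4 hqS]⟩
        · exact ⟨_, _, rfl, by rwa [h2 hqS]⟩
        · exact ⟨_, _, rfl, by rwa [h3 hqS]⟩
  constructor
  · intro i j hS
    by_contra hne
    have : wc i j ∈ C := ⟨hS, Or.inl ⟨i, j, rfl, hne⟩⟩
    rw [hC] at this; exact this
  · intro i j hS
    by_contra hne
    have : bc i j ∈ C := ⟨hS, Or.inr ⟨i, j, rfl, hne⟩⟩
    rw [hC] at this; exact this

/-- A sign. -/
def sg (x : ℤ) : ℤ := if Even x then 1 else -1

lemma sg_mul_self (x : ℤ) : sg x * sg x = 1 := by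
  unfold sg; split_ifs <;> rfl

lemma sg_add_one (x : ℤ) : sg (x + 1) = - sg x := by
  unfold sg
  by_cases h : Even x
  · simp [h, Int.even_add_one]
  · simp [h, Int.even_add_one]

lemma sg_sub_one (x : ℤ) : sg (x - 1) = - sg x := by
  have := sg_add_one (x - 1)
  rw [sub_add_cancel] at this
  rw [this, neg_neg]

section Kernel

variable {S : Finset Cell} {n : ℕ} {R : Type} [CommRing R]

/-- Extension of a vector indexed by the white cells to all cells. -/
def extendVec (ω : Fin n ≃ whiteCells S) (v : Fin n → R) (q : Cell) : R :=
  ∑ j, if q = (ω j : Cell) then v j else 0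

lemma extendVec_apply (ω : Fin n ≃ whiteCells S) (v : Fin n → R) (j : Fin n) :
    extendVec ω v (ω j) = v j := by
  unfold extendVec
  rw [Finset.sum_eq_single j]
  · simp
  · intro k _ hk
    rw [if_neg]
    intro h
    exact hk (ω.injective (Subtype.ext h.symm))
  · simp

lemma extendVec_eq_zero (ω : Fin n ≃ whiteCells S) (v : Fin n → R) (q : Cell)
    (hq : q ∉ S) : extendVec ω v q = 0 := by
  unfold extendVec
  apply Finset.sum_eq_zero
  intro k _
  rw [if_neg]
  rintro rfl
  exact hq (Finset.mem_filter.1 (ω k).2).1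

lemma exists_omega (ω : Fin n ≃ whiteCells S) (i j : ℤ) (h : wc i j ∈ S) :
    ∃ k, (ω k : Cell) = wc i j := by
  obtain ⟨k, hk⟩ := ω.surjective ⟨wc i j, Finset.mem_filter.2 ⟨h, wc_white i j⟩⟩
  exact ⟨k, by rw [hk]⟩

lemma exists_beta (β : Fin n ≃ blackCells S) (i j : ℤ) (h : bc i j ∈ S) :
    ∃ k, (β k : Cell) = bc i j := by
  obtain ⟨k, hk⟩ := β.surjective ⟨bc i j, Finset.mem_filter.2 ⟨h, bc_black i j⟩⟩
  exact ⟨k, by rw [hk]⟩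

/-- The adjacency matrix with coefficients in `R`. -/
def btwR (R : Type) [CommRing R] (β : Fin n ≃ blackCells S) (ω : Fin n ≃ whiteCells S) :
    Matrix (Fin n) (Fin n) R :=
  fun i j => if Adjacent (β i : Cell) (ω j : Cell) then 1 else 0

lemma btwR_mulVec (β : Fin n ≃ blackCells S) (ω : Fin n ≃ whiteCells S) (v : Fin n → R)
    (k : Fin n) (a b : ℤ) (hk : (β k : Cell) = bc a b) :
    (btwR R β ω).mulVec v k = extendVec ω v (wc a b) + extendVec ω v (wc (a + 1) (b + 1)) +
      extendVec ω v (wc (a + 1) b) + extendVec ω v (wc a (b + 1)) := by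
  simp only [extendVec, Matrix.mulVec, dotProduct, btwR, ← Finset.sum_add_distrib]
  apply Finset.sum_congr rfl
  intro j _
  rw [hk]
  simp only [adj_bc, @eq_comm _ (wc _ _)]
  have h12 : wc a b ≠ wc (a + 1) (b + 1) := fun h => by have := wc_inj h; omega
  have h13 : wc a b ≠ wc (a + 1) b := fun h => by have := wc_inj h; omega
  have h14 : wc a b ≠ wc a (b + 1) := fun h => by have := wc_inj h; omega
  have h23 : wc (a + 1) (b + 1) ≠ wc (a + 1) b := fun h => by have := wc_inj h; omega
  have h24 : wc (a + 1) (b + 1) ≠ wc a (b + 1) := fun h => by have := wc_inj h; omega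
  have h34 : wc (a + 1) b ≠ wc a (b + 1) := fun h => by have := wc_inj h; omega
  by_cases h1 : (ω j : Cell) = wc a b
  · simp [h1, h12, h13, h14]
  by_cases h2 : (ω j : Cell) = wc (a + 1) (b + 1)
  · simp [h2, h12.symm, h23, h24]
  by_cases h3 : (ω j : Cell) = wc (a + 1) b
  · simp [h3, h13.symm, h23.symm, h34]
  by_cases h4 : (ω j : Cell) = wc a (b + 1)
  · simp [h4, h14.symm, h24.symm, h34.symm]
  simp [h1, h2, h3, h4]

lemma kernel_iff_wave (β : Fin n ≃ blackCells S) (ω : Fin n ≃ whiteCells S)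
    (Bk Wh : Finset (ℤ × ℤ))
    (hB : ∀ i j, (i, j) ∈ Bk ↔ bc i j ∈ S) (hW : ∀ i j, (i, j) ∈ Wh ↔ wc i j ∈ S) :
    (∃ v : Fin n → R, v ≠ 0 ∧ (btwR R β ω).mulVec v = 0) ↔
      ∃ g : ℤ → ℤ → R, IsWave Bk Wh g ∧ ∃ i j, g i j ≠ 0 := by
  -- key computation
  have hss : ∀ x : ℤ, ((sg x : ℤ) : R) * ((sg x : ℤ) : R) = 1 := by
    intro x; rw [← Int.cast_mul, sg_mul_self, Int.cast_one]
  have key : ∀ (v : Fin n → R) (g : ℤ → ℤ → R),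
      (∀ i j, extendVec ω v (wc i j) = (sg (i - j) : ℤ) * g i j) →
      ∀ k a b, (β k : Cell) = bc a b → (btwR R β ω).mulVec v k =
        (sg (a - b) : ℤ) * (g a b + g (a + 1) (b + 1) - (g (a + 1) b + g a (b + 1))) := by
    intro v g h k a b hk
    rw [btwR_mulVec β ω v k a b hk, h, h, h, h]
    rw [show a + 1 - (b + 1) = a - b by ring, show a + 1 - b = a - b + 1 by ring,
      show a - (b + 1) = a - b - 1 by ring, sg_add_one, sg_sub_one]
    push_cast
    ring
  constructor
  · rintro ⟨v, hv, hMv⟩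
    let g : ℤ → ℤ → R := fun i j => (sg (i - j) : ℤ) * extendVec ω v (wc i j)
    have hg : ∀ i j, extendVec ω v (wc i j) = (sg (i - j) : ℤ) * g i j := by
      intro i j
      simp only [g]
      rw [← mul_assoc, hss, one_mul]
    refine ⟨g, ⟨?_, ?_⟩, ?_⟩
    · intro i j h
      rw [hW] at h
      simp only [g]
      rw [extendVec_eq_zero ω v _ h, mul_zero]
    · intro a b h
      rw [hB] at h
      obtain ⟨k, hk⟩ := exists_beta β a b h
      have h1 := key v g hg k a b hk
      rw [hMv] at h1
      have h2 := congrArg (fun t => ((sg (a - b) : ℤ) : R) * t) h1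
      simp only [Pi.zero_apply, mul_zero] at h2
      rw [← mul_assoc, hss, one_mul] at h2
      exact sub_eq_zero.1 h2.symm
    · obtain ⟨j, hj⟩ := Function.ne_iff.1 hv
      obtain ⟨a, b, hab⟩ := exists_wc (Finset.mem_filter.1 (ω j).2).2
      refine ⟨a, b, fun h0 => hj ?_⟩
      rw [← extendVec_apply ω v j, hab, hg, h0]
      simp
  · rintro ⟨g, hg, a, b, hab⟩
    have hc : ∀ j : Fin n, ∃ ab : ℤ × ℤ, (ω j : Cell) = wc ab.1 ab.2 := fun j => by
      obtain ⟨a, b, h⟩ := exists_wc (Finset.mem_filter.1 (ω j).2).2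
      exact ⟨(a, b), h⟩
    choose c hc using hc
    let v : Fin n → R := fun j => (sg ((c j).1 - (c j).2) : ℤ) * g (c j).1 (c j).2
    have hv : ∀ i j, extendVec ω v (wc i j) = (sg (i - j) : ℤ) * g i j := by
      intro i j
      by_cases h : wc i j ∈ S
      · obtain ⟨k, hk⟩ := exists_omega ω i j h
        rw [← hk, extendVec_apply]
        have := wc_inj ((hc k).symm.trans hk)
        simp only [v]
        rw [this.1, this.2]
      · rw [extendVec_eq_zero ω v _ h, hg.1 i j (by rwa [hW]), mul_zero]
    refine ⟨v, ?_, ?_⟩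
    · intro h0
      have h1 := hv a b
      rw [h0] at h1
      have h2 : extendVec ω (0 : Fin n → R) (wc a b) = 0 := by simp [extendVec]
      rw [h2] at h1
      have h3 := congrArg (fun t => ((sg (a - b) : ℤ) : R) * t) h1
      simp only [mul_zero] at h3
      rw [← mul_assoc, hss, one_mul] at h3
      exact hab h3.symm
    · funext k
      obtain ⟨a, b, hk⟩ := exists_bc (Finset.mem_filter.1 (β k).2).2
      rw [key v g hv k a b hk, hg.2 a b (by rw [hB, ← hk]; exact (Finset.mem_filter.1 (β k).2).1)]
      simp

end Kernel

lemma abs_det_le_one (S : Finset Cell) (hS : IsBoard S) (n : ℕ)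
    (β : Fin n ≃ blackCells S) (ω : Fin n ≃ whiteCells S) :
    |(btwMatrix β ω).det| ≤ 1 := by
  obtain ⟨Bk, Wh, hB, hW⟩ := exists_diag_finsets S
  have hZ : btwMatrix β ω = btwR ℤ β ω := rfl
  rw [hZ]
  by_cases h0 : (btwR ℤ β ω).det = 0
  · simp [h0]
  suffices h : (btwR ℤ β ω).det.natAbs = 1 by
    rw [Int.abs_eq_natAbs, h]; simp
  by_contra hne
  obtain ⟨p, hp, hdvd⟩ := Nat.exists_prime_and_dvd hne
  have : Fact p.Prime := ⟨hp⟩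
  have hdet : (btwR (ZMod p) β ω).det = 0 := by
    have hmap : btwR (ZMod p) β ω = (Int.castRingHom (ZMod p)).mapMatrix (btwR ℤ β ω) := by
      ext i j
      simp only [btwR, RingHom.mapMatrix_apply, Matrix.map_apply]
      split_ifs <;> simp
    rw [hmap, ← RingHom.map_det]
    simp only [eq_intCast]
    rw [ZMod.intCast_zmod_eq_zero_iff_dvd]
    exact Int.natCast_dvd.2 hdvd
  obtain ⟨g, hg, hgne⟩ := (kernel_iff_wave β ω Bk Wh hB hW).1
    (Matrix.exists_mulVec_eq_zero_iff.2 hdet)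
  obtain hw := exists_int_wave Bk Wh (board_hT S hS Bk Wh hB hW) g hg hgne
  exact h0 (Matrix.exists_mulVec_eq_zero_iff.1 ((kernel_iff_wave β ω Bk Wh hB hW).2 hw))

section Tilings

variable {S : Finset Cell} {n : ℕ}

/-- The set of dominoes associated to a permutation. -/
def toTiling (β : Fin n ≃ blackCells S) (ω : Fin n ≃ whiteCells S)
    (σ : Equiv.Perm (Fin n)) : Finset (Finset Cell) :=
  Finset.univ.image (fun j => ({(β (σ j) : Cell), (ω j : Cell)} : Finset Cell))

lemma beta_ne_omega (β : Fin n ≃ blackCells S) (ω : Fin n ≃ whiteCells S) (i j : Fin n) :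
    (β i : Cell) ≠ (ω j : Cell) := by
  intro h
  have h1 := (Finset.mem_filter.1 (β i).2).2
  have h2 := (Finset.mem_filter.1 (ω j).2).2
  rw [h] at h1
  exact h2 h1

lemma pair_eq_iff (β : Fin n ≃ blackCells S) (ω : Fin n ≃ whiteCells S) (i j i' j' : Fin n) :
    ({(β i : Cell), (ω j : Cell)} : Finset Cell) = {(β i' : Cell), (ω j' : Cell)} ↔
      i = i' ∧ j = j' := by
  constructor
  · intro h
    have h1 : (β i : Cell) ∈ ({(β i' : Cell), (ω j' : Cell)} : Finset Cell) := by
      rw [← h]; simp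
    have h2 : (ω j : Cell) ∈ ({(β i' : Cell), (ω j' : Cell)} : Finset Cell) := by
      rw [← h]; simp
    rw [Finset.mem_insert, Finset.mem_singleton] at h1 h2
    refine ⟨?_, ?_⟩
    · rcases h1 with h1 | h1
      · exact β.injective (Subtype.ext h1)
      · exact absurd h1 (beta_ne_omega β ω i j')
    · rcases h2 with h2 | h2
      · exact absurd h2.symm (beta_ne_omega β ω i' j)
      · exact ω.injective (Subtype.ext h2)
  · rintro ⟨rfl, rfl⟩; rfl

lemma permRepresents_toTiling (β : Fin n ≃ blackCells S) (ω : Fin n ≃ whiteCells S)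
    (σ : Equiv.Perm (Fin n)) : PermRepresents β ω (toTiling β ω σ) σ := by
  intro i j
  simp only [toTiling, Finset.mem_image, Finset.mem_univ, true_and, pair_eq_iff]
  constructor
  · intro h; exact ⟨j, h, rfl⟩
  · rintro ⟨j', h, rfl⟩; exact h

lemma permRepresents_unique (β : Fin n ≃ blackCells S) (ω : Fin n ≃ whiteCells S)
    {τ : Finset (Finset Cell)} {σ π : Equiv.Perm (Fin n)}
    (h1 : PermRepresents β ω τ σ) (h2 : PermRepresents β ω τ π) : σ = π := by
  ext j
  rw [(h1 (π j) j).2 ((h2 (π j) j).1 rfl)]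

lemma toTiling_injective (β : Fin n ≃ blackCells S) (ω : Fin n ≃ whiteCells S) :
    Function.Injective (toTiling β ω) := by
  intro σ π h
  refine permRepresents_unique β ω (permRepresents_toTiling β ω σ) ?_
  rw [h]
  exact permRepresents_toTiling β ω π

lemma tilingSign_toTiling (β : Fin n ≃ blackCells S) (ω : Fin n ≃ whiteCells S)
    (σ : Equiv.Perm (Fin n)) : tilingSign β ω (toTiling β ω σ) = Equiv.Perm.sign σ := by
  have h : ∃ π : Equiv.Perm (Fin n), PermRepresents β ω (toTiling β ω σ) π :=
    ⟨σ, permRepresents_toTiling β ω σ⟩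
  unfold tilingSign
  rw [dif_pos h, permRepresents_unique β ω h.choose_spec (permRepresents_toTiling β ω σ)]

lemma cell_cases (β : Fin n ≃ blackCells S) (ω : Fin n ≃ whiteCells S) (p : Cell) (hp : p ∈ S) :
    (IsBlackCell p ∧ ∃ i, (β i : Cell) = p) ∨ (¬ IsBlackCell p ∧ ∃ j, (ω j : Cell) = p) := by
  by_cases h : IsBlackCell p
  · exact Or.inl ⟨h, β.symm ⟨p, Finset.mem_filter.2 ⟨hp, h⟩⟩, by simp⟩
  · exact Or.inr ⟨h, ω.symm ⟨p, Finset.mem_filter.2 ⟨hp, h⟩⟩, by simp⟩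

lemma adjacent_colour {p q : Cell} (h : Adjacent p q) : IsBlackCell p ↔ ¬ IsBlackCell q := by
  obtain ⟨a, b⟩ := p
  obtain ⟨c, d⟩ := q
  simp only [Adjacent, IsBlackCell, Prod.mk_sub_mk, Prod.mk.injEq, Int.even_iff] at *
  omega

lemma adjacent_comm' {p q : Cell} (h : Adjacent p q) : Adjacent q p := by
  obtain ⟨a, b⟩ := p
  obtain ⟨c, d⟩ := q
  simp only [Adjacent, Prod.mk_sub_mk, Prod.mk.injEq] at *
  omega

lemma domino_form (β : Fin n ≃ blackCells S) (ω : Fin n ≃ whiteCells S) (d : Finset Cell)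
    (hd : IsDomino d) (hdS : d ⊆ S) :
    ∃ i j, Adjacent (β i : Cell) (ω j : Cell) ∧ d = {(β i : Cell), (ω j : Cell)} := by
  obtain ⟨p, q, hpq, rfl⟩ := hd
  have hp : p ∈ S := hdS (by simp)
  have hq : q ∈ S := hdS (by simp)
  have hc := adjacent_colour hpq
  rcases cell_cases β ω p hp with ⟨hb, i, rfl⟩ | ⟨hb, i, rfl⟩
  · rcases cell_cases β ω q hq with ⟨hb', j, rfl⟩ | ⟨hb', j, rfl⟩
    · exact absurd hb' (hc.1 hb)
    · exact ⟨i, j, hpq, rfl⟩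
  · rcases cell_cases β ω q hq with ⟨hb', j, rfl⟩ | ⟨hb', j, rfl⟩
    · exact ⟨j, i, adjacent_comm' hpq, Finset.pair_comm _ _⟩
    · exact absurd (hc.2 hb') hb

lemma isTiling_toTiling (β : Fin n ≃ blackCells S) (ω : Fin n ≃ whiteCells S)
    (σ : Equiv.Perm (Fin n)) (hσ : ∀ j, Adjacent (β (σ j) : Cell) (ω j : Cell)) :
    IsTiling S (toTiling β ω σ) := by
  refine ⟨?_, ?_, ?_⟩
  · intro d hd
    simp only [toTiling, Finset.mem_image, Finset.mem_univ, true_and] at hd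
    obtain ⟨j, rfl⟩ := hd
    exact ⟨_, _, hσ j, rfl⟩
  · intro d hd
    simp only [toTiling, Finset.mem_image, Finset.mem_univ, true_and] at hd
    obtain ⟨j, rfl⟩ := hd
    intro p hp
    rw [Finset.mem_insert, Finset.mem_singleton] at hp
    rcases hp with rfl | rfl
    · exact (Finset.mem_filter.1 (β (σ j)).2).1
    · exact (Finset.mem_filter.1 (ω j).2).1
  · intro p hp
    rcases cell_cases β ω p hp with ⟨-, i, rfl⟩ | ⟨-, j, rfl⟩
    · refine ⟨{(β i : Cell), (ω (σ.symm i) : Cell)}, ⟨?_, by simp⟩, ?_⟩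
      · exact (permRepresents_toTiling β ω σ i (σ.symm i)).1 (by simp)
      · rintro d ⟨hd, hid⟩
        simp only [toTiling, Finset.mem_image, Finset.mem_univ, true_and] at hd
        obtain ⟨j, rfl⟩ := hd
        rw [Finset.mem_insert, Finset.mem_singleton] at hid
        rcases hid with h | h
        · have : i = σ j := β.injective (Subtype.ext h)
          subst this
          simp
        · exact absurd h (beta_ne_omega β ω i j)
    · refine ⟨{(β (σ j) : Cell), (ω j : Cell)}, ⟨?_, by simp⟩, ?_⟩
      · exact (permRepresents_toTiling β ω σ (σ j) j).1 rfl
      · rintro d ⟨hd, hid⟩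
        simp only [toTiling, Finset.mem_image, Finset.mem_univ, true_and] at hd
        obtain ⟨j', rfl⟩ := hd
        rw [Finset.mem_insert, Finset.mem_singleton] at hid
        rcases hid with h | h
        · exact absurd h.symm (beta_ne_omega β ω _ _)
        · have : j = j' := ω.injective (Subtype.ext h)
          subst this
          rfl

lemma exists_perm_of_isTiling (β : Fin n ≃ blackCells S) (ω : Fin n ≃ whiteCells S)
    (τ : Finset (Finset Cell)) (hτ : IsTiling S τ) :
    ∃ σ : Equiv.Perm (Fin n), (∀ j, Adjacent (β (σ j) : Cell) (ω j : Cell)) ∧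
      toTiling β ω σ = τ := by
  obtain ⟨h1, h2, h3⟩ := hτ
  have key : ∀ j, ∃ i, Adjacent (β i : Cell) (ω j : Cell) ∧
      ({(β i : Cell), (ω j : Cell)} : Finset Cell) ∈ τ := by
    intro j
    obtain ⟨d, ⟨hd, hjd⟩, -⟩ := h3 (ω j) (Finset.mem_filter.1 (ω j).2).1
    obtain ⟨i, j', hadj, rfl⟩ := domino_form β ω d (h1 d hd) (h2 d hd)
    rw [Finset.mem_insert, Finset.mem_singleton] at hjd
    rcases hjd with h | h
    · exact absurd h.symm (beta_ne_omega β ω _ _)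
    · have : j = j' := ω.injective (Subtype.ext h)
      subst this
      exact ⟨i, hadj, hd⟩
  choose f hf1 hf2 using key
  have hinj : Function.Injective f := by
    intro j j' hjj
    have hu := (h3 (β (f j)) (Finset.mem_filter.1 (β (f j)).2).1).unique
      ⟨hf2 j, by simp⟩ ⟨hf2 j', by rw [hjj]; simp⟩
    exact ((pair_eq_iff β ω _ _ _ _).1 hu).2
  refine ⟨Equiv.ofBijective f (Finite.injective_iff_bijective.1 hinj), hf1, ?_⟩
  ext d
  simp only [toTiling, Finset.mem_image, Finset.mem_univ, true_and, Equiv.ofBijective_apply]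
  constructor
  · rintro ⟨j, rfl⟩
    exact hf2 j
  · intro hd
    obtain ⟨i, j, hadj, rfl⟩ := domino_form β ω d (h1 d hd) (h2 d hd)
    refine ⟨j, ?_⟩
    exact (h3 (ω j) (Finset.mem_filter.1 (ω j).2).1).unique ⟨hf2 j, by simp⟩ ⟨hd, by simp⟩

lemma ncard_tilings (β : Fin n ≃ blackCells S) (ω : Fin n ≃ whiteCells S) (s : ℤˣ) :
    {τ | IsTiling S τ ∧ tilingSign β ω τ = s}.ncard =
      (Finset.univ.filter (fun σ : Equiv.Perm (Fin n) =>
        (∀ j, Adjacent (β (σ j) : Cell) (ω j : Cell)) ∧ Equiv.Perm.sign σ = s)).card := by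
  have : {τ | IsTiling S τ ∧ tilingSign β ω τ = s} = toTiling β ω ''
      ((Finset.univ.filter (fun σ : Equiv.Perm (Fin n) =>
        (∀ j, Adjacent (β (σ j) : Cell) (ω j : Cell)) ∧ Equiv.Perm.sign σ = s) :
          Finset (Equiv.Perm (Fin n))) : Set (Equiv.Perm (Fin n))) := by
    ext τ
    simp only [Set.mem_setOf_eq, Set.mem_image, Finset.coe_filter, Finset.mem_univ, true_and]
    constructor
    · rintro ⟨hτ, hs⟩
      obtain ⟨σ, hσ, rfl⟩ := exists_perm_of_isTiling β ω τ hτ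
      rw [tilingSign_toTiling] at hs
      exact ⟨σ, ⟨hσ, hs⟩, rfl⟩
    · rintro ⟨σ, ⟨hσ, hs⟩, rfl⟩
      exact ⟨isTiling_toTiling β ω σ hσ, by rw [tilingSign_toTiling, hs]⟩
  rw [this, Set.ncard_image_of_injective _ (toTiling_injective β ω), Set.ncard_coe_finset]

lemma ncard_sub_eq_det (β : Fin n ≃ blackCells S) (ω : Fin n ≃ whiteCells S) :
    ({τ | IsTiling S τ ∧ tilingSign β ω τ = 1}.ncard : ℤ) -
      ({τ | IsTiling S τ ∧ tilingSign β ω τ = -1}.ncard : ℤ) = (btwMatrix β ω).det := by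
  rw [ncard_tilings, ncard_tilings, Matrix.det_apply', Finset.card_filter, Finset.card_filter]
  push_cast
  rw [← Finset.sum_sub_distrib]
  refine Finset.sum_congr rfl fun σ _ => ?_
  by_cases hσ : ∀ j, Adjacent (β (σ j) : Cell) (ω j : Cell)
  · have hprod : ∏ j, btwMatrix β ω (σ j) j = 1 :=
      Finset.prod_eq_one fun j _ => if_pos (hσ j)
    rw [hprod]
    rcases Int.units_eq_one_or (Equiv.Perm.sign σ) with h | h
    · rw [h, if_pos ⟨hσ, rfl⟩, if_neg (fun h => absurd h.2 (by decide))]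
      simp
    · rw [h, if_neg (fun h => absurd h.2 (by decide)), if_pos ⟨hσ, rfl⟩]
      simp
  · rw [if_neg (fun h => hσ h.1), if_neg (fun h => hσ h.1)]
    push Not at hσ
    obtain ⟨j, hj⟩ := hσ
    have hprod : ∏ j, btwMatrix β ω (σ j) j = 0 :=
      Finset.prod_eq_zero (Finset.mem_univ j) (if_neg hj)
    rw [hprod]
    simp

end Tilings

/-- **Theorem.** For a board with equally many black and white cells, the number
of even domino tilings and the number of odd domino tilings differ by at most
one. -/
theorem card_even_tilings_sub_card_odd_tilings_le_one
    (S : Finset Cell) (hS : IsBoard S) (n : ℕ)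
    (β : Fin n ≃ blackCells S) (ω : Fin n ≃ whiteCells S) :
    |({τ | IsTiling S τ ∧ tilingSign β ω τ = 1}.ncard : ℤ) -
      ({τ | IsTiling S τ ∧ tilingSign β ω τ = -1}.ncard : ℤ)| ≤ 1 := by
  rw [ncard_sub_eq_det]
  exact abs_det_le_one S hS n β ω
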